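/- Let ℒ = −Δ + V with V ∈ RH_q, q > n, and suppose the kernel difference bound |R^ℒ_ℓ(x,y) − R_ℓ(x-y)| ≤ C |x-y|^{-n} (|x-y|/γ(x))^{2-n/q} holds for |x-y| < γ(x_k), with γ(x) ∼ γ(x_k) on Q_k^*. Then for f ∈ BMO^ℒ(ℝⁿ) and x ∈ Q_k^*, ∫_{|x-y|<γ(x_k)} |R^ℒ_ℓ(x,y) − R_ℓ(x-y)| |f(y)| dy ≤ C ‖f‖_{BMO^ℒ(ℝⁿ)}, with C independent of k. -/

import Mathlib

open MeasureTheory Set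
open scoped ENNReal

noncomputable section

/-- The average of `f` over a set `s` (with respect to Lebesgue measure). -/
def avgOn {n : ℕ} (f : EuclideanSpace ℝ (Fin n) → ℝ) (s : Set (EuclideanSpace ℝ (Fin n))) : ℝ :=
  ((volume s).toReal)⁻¹ * ∫ y in s, f y

/-- `f ∈ BMO^ℒ(ℝⁿ)` with norm at most `M`, relative to the critical radius function `γ`:
the mean oscillation of `f` over every ball is `≤ M`, and the mean of `|f|` over every
ball of radius `r ≥ γ(center)` is `≤ M`. -/
def IsBMOLWith {n : ℕ} (γ : EuclideanSpace ℝ (Fin n) → ℝ)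
    (f : EuclideanSpace ℝ (Fin n) → ℝ) (M : ℝ) : Prop :=
  (∀ (z : EuclideanSpace ℝ (Fin n)) (r : ℝ), 0 < r →
    ((volume (Metric.ball z r)).toReal)⁻¹ *
      ∫ y in Metric.ball z r, |f y - avgOn f (Metric.ball z r)| ≤ M) ∧
  (∀ (z : EuclideanSpace ℝ (Fin n)) (r : ℝ), γ z ≤ r →
    ((volume (Metric.ball z r)).toReal)⁻¹ * ∫ y in Metric.ball z r, |f y| ≤ M)

lemma bmol_integrableOn {n : ℕ} {f : EuclideanSpace ℝ (Fin n) → ℝ}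
    (hf : LocallyIntegrable f volume) (x : EuclideanSpace ℝ (Fin n)) (r : ℝ) :
    IntegrableOn f (Metric.ball x r) volume :=
  (hf.integrableOn_isCompact (isCompact_closedBall x r)).mono_set Metric.ball_subset_closedBall

lemma bmol_ball_vol {n : ℕ} (x : EuclideanSpace ℝ (Fin n)) {r : ℝ} (hr : 0 < r) :
    (volume (Metric.ball x r)).toReal
      = r ^ n * (volume (Metric.ball (0 : EuclideanSpace ℝ (Fin n)) 1)).toReal := by
  rw [Measure.addHaar_ball_of_pos _ _ hr, ENNReal.toReal_mul, finrank_euclideanSpace_fin,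
    ENNReal.toReal_ofReal (by positivity)]

lemma bmol_unit_pos (n : ℕ) :
    0 < (volume (Metric.ball (0 : EuclideanSpace ℝ (Fin n)) 1)).toReal :=
  ENNReal.toReal_pos (Metric.measure_ball_pos _ _ one_pos).ne' measure_ball_lt_top.ne

/-- Integral of `|f|` against the oscillation bound. -/
lemma bmol_osc {n : ℕ} {γ f : EuclideanSpace ℝ (Fin n) → ℝ} {M : ℝ}
    (hB : IsBMOLWith γ f M) (x : EuclideanSpace ℝ (Fin n)) {r : ℝ} (hr : 0 < r) :
    ∫ y in Metric.ball x r, |f y - avgOn f (Metric.ball x r)|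
      ≤ (volume (Metric.ball x r)).toReal * M := by
  have h := hB.1 x r hr
  have hv : 0 < (volume (Metric.ball x r)).toReal := by
    rw [bmol_ball_vol x hr]; have := bmol_unit_pos n; positivity
  rwa [inv_mul_le_iff₀ hv] at h

lemma bmol_avg_step {n : ℕ} {γ f : EuclideanSpace ℝ (Fin n) → ℝ} {M : ℝ}
    (hf : LocallyIntegrable f volume)
    (hB : IsBMOLWith γ f M) (x : EuclideanSpace ℝ (Fin n)) {r : ℝ} (hr : 0 < r) :
    |avgOn f (Metric.ball x (r / 2))| ≤ |avgOn f (Metric.ball x r)| + 2 ^ n * M := by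
  have hr2 : 0 < r / 2 := by positivity
  have hu := bmol_unit_pos n
  have h := bmol_osc hB x hr
  rw [bmol_ball_vol x hr] at h
  have hv := bmol_ball_vol x hr2
  set u := (volume (Metric.ball (0 : EuclideanSpace ℝ (Fin n)) 1)).toReal
  set a := avgOn f (Metric.ball x r) with ha
  have hsub : Metric.ball x (r / 2) ⊆ Metric.ball x r := Metric.ball_subset_ball (by linarith)
  have hi := bmol_integrableOn hf x r
  have hi2 := bmol_integrableOn hf x (r / 2)
  have hc : IntegrableOn (fun _ : EuclideanSpace ℝ (Fin n) => a) (Metric.ball x r) volume :=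
    integrableOn_const measure_ball_lt_top.ne
  have hc2 := hc.mono_set hsub
  have hmono : ∫ y in Metric.ball x (r / 2), |f y - a| ≤ ∫ y in Metric.ball x r, |f y - a| :=
    setIntegral_mono_set (hi.sub hc).abs (Filter.Eventually.of_forall fun _ => abs_nonneg _)
      hsub.eventuallyLE
  have habs : |∫ y in Metric.ball x (r / 2), (f y - a)|
      ≤ ∫ y in Metric.ball x (r / 2), |f y - a| := abs_integral_le_integral_abs
  have hsplit : ∫ y in Metric.ball x (r / 2), (f y - a)
      = (∫ y in Metric.ball x (r / 2), f y) - (r / 2) ^ n * u * a := by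
    rw [integral_sub hi2 hc2, setIntegral_const, Measure.real, hv, smul_eq_mul]
  have hw : 0 < (r / 2) ^ n * u := by positivity
  have key : avgOn f (Metric.ball x (r / 2)) - a
      = ((r / 2) ^ n * u)⁻¹ * ∫ y in Metric.ball x (r / 2), (f y - a) := by
    rw [hsplit, avgOn, hv]; field_simp
  have h2 : |avgOn f (Metric.ball x (r / 2)) - a| ≤ 2 ^ n * M := by
    rw [key, abs_mul, abs_of_pos (inv_pos.2 hw), inv_mul_le_iff₀ hw]
    refine (habs.trans (hmono.trans h)).trans (le_of_eq ?_)
    rw [div_pow]; field_simp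
  have h3 := abs_sub_abs_le_abs_sub (avgOn f (Metric.ball x (r / 2))) a
  linarith

lemma bmol_avg_bound {n : ℕ} {γ f : EuclideanSpace ℝ (Fin n) → ℝ} {M : ℝ}
    (hf : LocallyIntegrable f volume)
    (hB : IsBMOLWith γ f M) (x : EuclideanSpace ℝ (Fin n)) {r : ℝ} (hr : 0 < r)
    (hγ : γ x ≤ r) (j : ℕ) :
    |avgOn f (Metric.ball x (r * (1 / 2) ^ j))| ≤ M + j * (2 ^ n * M) := by
  induction j with
  | zero =>
    have h := hB.2 x r hγ
    simp only [pow_zero, mul_one, Nat.cast_zero, zero_mul, add_zero]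
    refine le_trans ?_ h
    rw [avgOn, abs_mul, abs_of_nonneg (inv_nonneg.2 ENNReal.toReal_nonneg)]
    exact mul_le_mul_of_nonneg_left abs_integral_le_integral_abs
      (inv_nonneg.2 ENNReal.toReal_nonneg)
  | succ k ih =>
    have h := bmol_avg_step hf hB x (r := r * (1 / 2) ^ k) (by positivity)
    have e : r * (1 / 2) ^ (k + 1) = r * (1 / 2) ^ k / 2 := by ring
    rw [e]; push_cast; linarith

lemma bmol_int_bound {n : ℕ} {γ f : EuclideanSpace ℝ (Fin n) → ℝ} {M : ℝ} (hM : 0 ≤ M)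
    (hn : 1 ≤ n) (hf : LocallyIntegrable f volume)
    (hB : IsBMOLWith γ f M) (x : EuclideanSpace ℝ (Fin n)) {r : ℝ} (hr : 0 < r)
    (hγ : γ x ≤ r) (j : ℕ) :
    ∫ y in Metric.ball x (r * (1 / 2) ^ j), |f y| ≤
      (r * (1 / 2) ^ j) ^ n * (volume (Metric.ball (0 : EuclideanSpace ℝ (Fin n)) 1)).toReal
        * (2 ^ n * ((j : ℝ) + 1) * M) := by
  have ha := bmol_avg_bound hf hB x hr hγ j
  have hρ : 0 < r * (1 / 2) ^ j := by positivity
  set ρ := r * (1 / 2) ^ j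
  have h := bmol_osc hB x hρ
  rw [← bmol_ball_vol x hρ]
  set a := avgOn f (Metric.ball x ρ)
  have hi := bmol_integrableOn hf x ρ
  have hc : IntegrableOn (fun _ : EuclideanSpace ℝ (Fin n) => a) (Metric.ball x ρ) volume :=
    integrableOn_const measure_ball_lt_top.ne
  have hle : ∫ y in Metric.ball x ρ, |f y|
      ≤ ∫ y in Metric.ball x ρ, (|f y - a| + |a|) := by
    refine integral_mono hi.abs ((hi.sub hc).abs.add hc.abs) fun y => ?_
    have := abs_add_le (f y - a) a
    simpa using this
  have hia : IntegrableOn (fun y => |f y - a|) (Metric.ball x ρ) volume := (hi.sub hc).abs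
  have hca : IntegrableOn (fun _ : EuclideanSpace ℝ (Fin n) => |a|) (Metric.ball x ρ) volume :=
    hc.abs
  rw [integral_add hia hca, setIntegral_const, Measure.real, smul_eq_mul] at hle
  have h2 : (2 : ℝ) ≤ 2 ^ n := by
    calc (2 : ℝ) = 2 ^ 1 := by norm_num
      _ ≤ 2 ^ n := pow_le_pow_right₀ (by norm_num) hn
  have hv : 0 ≤ (volume (Metric.ball x ρ)).toReal := ENNReal.toReal_nonneg
  have h3 : M + |a| ≤ 2 ^ n * ((j : ℝ) + 1) * M := by nlinarith
  nlinarith [mul_le_mul_of_nonneg_left h3 hv]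

lemma bmol_summable : Summable fun j : ℕ => ((j : ℝ) + 1) * (1 / 2 : ℝ) ^ j := by
  have h1 := summable_pow_mul_geometric_of_norm_lt_one (R := ℝ) 1 (r := 1 / 2) (by norm_num)
  have h0 := summable_geometric_of_lt_one (r := (1 / 2 : ℝ)) (by norm_num) (by norm_num)
  refine (h1.add h0).congr fun j => ?_
  ring

/-- let `ℒ = -Δ + V`, `V ∈ RH_q` with `q > n` and critical radius `γ`,
and suppose the difference `D x y = R^ℒ_ℓ(x,y) - R_ℓ(x-y)` between the Schrödinger and
the classical Riesz kernels satisfies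
`|D x y| ≤ C₀ |x-y|^{-n} (|x-y|/γ(x))^{2-n/q}` for `|x-y| < γ(x_k)`, where
`γ(x) ∼ γ(x_k)` (comparability within a factor `2`). Then for `f ∈ BMO^ℒ(ℝⁿ)` with
norm at most `M`,
`∫_{|x-y| < γ(x_k)} |D x y| |f(y)| dy ≤ C M`, with `C` independent of `k`. -/
theorem schrodinger_riesz_local_difference_estimate (n : ℕ) (hn : 1 ≤ n) (C₀ q : ℝ)
    (hC₀ : 0 < C₀) (hq : (n : ℝ) < q) :
    ∃ C > 0, ∀ (γ : EuclideanSpace ℝ (Fin n) → ℝ)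
      (D : EuclideanSpace ℝ (Fin n) → EuclideanSpace ℝ (Fin n) → ℝ)
      (f : EuclideanSpace ℝ (Fin n) → ℝ) (M γk : ℝ)
      (x : EuclideanSpace ℝ (Fin n)),
      (∀ z, 0 < γ z) → 0 ≤ M → LocallyIntegrable f volume → IsBMOLWith γ f M →
      0 < γk → γk / 2 ≤ γ x → γ x ≤ 2 * γk →
      (∀ y : EuclideanSpace ℝ (Fin n), x ≠ y → ‖x - y‖ < γk →
        |D x y| ≤ C₀ * ‖x - y‖ ^ (-(n : ℝ)) * (‖x - y‖ / γ x) ^ (2 - (n : ℝ) / q)) →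
      ∫⁻ y in Metric.ball x γk, ENNReal.ofReal (|D x y| * |f y|)
        ≤ ENNReal.ofReal (C * M) := by
  have hu := bmol_unit_pos n
  set u := (volume (Metric.ball (0 : EuclideanSpace ℝ (Fin n)) 1)).toReal with hudef
  set T := ∑' j : ℕ, ((j : ℝ) + 1) * (1 / 2 : ℝ) ^ j with hT
  have hT0 : 0 ≤ T := tsum_nonneg fun j => by positivity
  refine ⟨C₀ * 4 ^ n * 4 * u * 2 ^ n * (T + 1), by positivity, ?_⟩
  intro γ D f M r x hγ hM hf hB hr h1 h2 hD
  have hn0 : (0 : ℝ) < n := by exact_mod_cast hn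
  have hq0 : 0 < q := hn0.trans hq
  have hnq : (n : ℝ) / q < 1 := (div_lt_one hq0).2 hq
  have hnq0 : 0 < (n : ℝ) / q := by positivity
  set δ := 2 - (n : ℝ) / q with hδ
  set K := C₀ * 4 ^ n * 4 * u * 2 ^ n with hK
  have hK0 : 0 < K := by positivity
  let S : ℕ → Set (EuclideanSpace ℝ (Fin n)) := fun j =>
    {y | r * (1 / 2) ^ (j + 1) < ‖x - y‖ ∧ ‖x - y‖ ≤ r * (1 / 2) ^ j ∧ ‖x - y‖ < r}
  have hSm : ∀ j, MeasurableSet (S j) := by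
    intro j
    have hm : Measurable fun y : EuclideanSpace ℝ (Fin n) => ‖x - y‖ := by fun_prop
    exact (measurableSet_lt measurable_const hm).inter
      ((measurableSet_le hm measurable_const).inter (measurableSet_lt hm measurable_const))
  have hcov : Metric.ball x r ⊆ {x} ∪ ⋃ j, S j := by
    intro y hy
    by_cases hxy : x = y
    · left; simp [hxy]
    · right
      have hlt : ‖x - y‖ < r := by
        rw [Metric.mem_ball, dist_comm, dist_eq_norm] at hy; exact hy
      have hp : 0 < ‖x - y‖ := norm_pos_iff.2 (sub_ne_zero.2 hxy)
      obtain ⟨j, hj1, hj2⟩ := exists_nat_pow_near_of_lt_one (x := ‖x - y‖ / r) (y := (1 / 2 : ℝ))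
        (by positivity) ((div_le_one hr).2 hlt.le) (by norm_num) (by norm_num)
      rw [lt_div_iff₀ hr] at hj1
      rw [div_le_iff₀ hr] at hj2
      exact mem_iUnion.2 ⟨j, by linarith, by linarith, hlt⟩
  have hpt : ∀ j, ∀ y ∈ S j, ENNReal.ofReal (|D x y| * |f y|) ≤
      ENNReal.ofReal (C₀ * (4 ^ n * ((2 * r * (1 / 2) ^ j) ^ n)⁻¹) * (4 * (1 / 2) ^ j))
        * ENNReal.ofReal |f y| := by
    intro j y hy
    obtain ⟨hy1, hy2, hy3⟩ := hy
    have hp : 0 < ‖x - y‖ := lt_trans (by positivity) hy1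
    have hne : x ≠ y := sub_ne_zero.1 (norm_pos_iff.1 hp)
    rw [← ENNReal.ofReal_mul (by positivity)]
    refine ENNReal.ofReal_le_ofReal (mul_le_mul_of_nonneg_right ?_ (abs_nonneg _))
    refine (hD y hne hy3).trans ?_
    have e1 : ‖x - y‖ ^ (-(n : ℝ)) ≤ 4 ^ n * ((2 * r * (1 / 2) ^ j) ^ n)⁻¹ := by
      rw [Real.rpow_neg hp.le, Real.rpow_natCast]
      have e : 4 ^ n * ((2 * r * (1 / 2) ^ j) ^ n)⁻¹ = ((r * (1 / 2) ^ (j + 1)) ^ n)⁻¹ := by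
        rw [← inv_pow, ← inv_pow, ← mul_pow]
        congr 1
        rw [pow_succ]; field_simp; norm_num
      rw [e]
      gcongr
    have e2 : (‖x - y‖ / γ x) ^ δ ≤ 4 * (1 / 2) ^ j := by
      have hγx := hγ x
      have a1 : ‖x - y‖ / γ x ≤ 2 * (1 / 2) ^ j := by
        rw [div_le_iff₀ hγx]
        have : (0 : ℝ) < (1 / 2) ^ j := by positivity
        nlinarith
      calc (‖x - y‖ / γ x) ^ δ ≤ (2 * (1 / 2) ^ j) ^ δ :=
            Real.rpow_le_rpow (by positivity) a1 (by linarith)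
        _ = 2 ^ δ * ((1 / 2) ^ j) ^ δ := Real.mul_rpow (by norm_num) (by positivity)
        _ ≤ 4 * (1 / 2) ^ j := by
            refine mul_le_mul ?_ ?_ (by positivity) (by norm_num)
            · calc (2 : ℝ) ^ δ ≤ 2 ^ (2 : ℝ) :=
                    Real.rpow_le_rpow_of_exponent_le (by norm_num) (by linarith)
                _ = 4 := by norm_num
            · calc ((1 / 2 : ℝ) ^ j) ^ δ ≤ ((1 / 2 : ℝ) ^ j) ^ (1 : ℝ) :=
                    Real.rpow_le_rpow_of_exponent_ge (by positivity)
                      (pow_le_one₀ (by norm_num) (by norm_num)) (by linarith)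
                _ = (1 / 2) ^ j := Real.rpow_one _
    have hγx := hγ x
    gcongr
  have hSj : ∀ j, ∫⁻ y in S j, ENNReal.ofReal (|D x y| * |f y|) ≤
      ENNReal.ofReal (K * M * (((j : ℝ) + 1) * (1 / 2) ^ j)) := by
    intro j
    have hsub : S j ⊆ Metric.ball x (2 * r * (1 / 2) ^ j) := by
      intro y hy
      rw [Metric.mem_ball, dist_comm, dist_eq_norm]
      have : 0 < r * (1 / 2) ^ j := by positivity
      have := hy.2.1
      linarith
    have hint := bmol_int_bound hM hn hf hB x (r := 2 * r) (by positivity) h2 j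
    calc ∫⁻ y in S j, ENNReal.ofReal (|D x y| * |f y|)
        ≤ ∫⁻ y in S j, ENNReal.ofReal
            (C₀ * (4 ^ n * ((2 * r * (1 / 2) ^ j) ^ n)⁻¹) * (4 * (1 / 2) ^ j))
              * ENNReal.ofReal |f y| := setLIntegral_mono' (hSm j) (hpt j)
      _ ≤ ∫⁻ y in Metric.ball x (2 * r * (1 / 2) ^ j), ENNReal.ofReal
            (C₀ * (4 ^ n * ((2 * r * (1 / 2) ^ j) ^ n)⁻¹) * (4 * (1 / 2) ^ j))
              * ENNReal.ofReal |f y| := lintegral_mono_set hsub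
      _ = ENNReal.ofReal (C₀ * (4 ^ n * ((2 * r * (1 / 2) ^ j) ^ n)⁻¹) * (4 * (1 / 2) ^ j))
            * ENNReal.ofReal (∫ y in Metric.ball x (2 * r * (1 / 2) ^ j), |f y|) := by
          rw [lintegral_const_mul' _ _ ENNReal.ofReal_ne_top,
            ofReal_integral_eq_lintegral_ofReal (bmol_integrableOn hf x _).abs
              (Filter.Eventually.of_forall fun _ => abs_nonneg _)]
      _ ≤ ENNReal.ofReal (K * M * (((j : ℝ) + 1) * (1 / 2) ^ j)) := by
          rw [← ENNReal.ofReal_mul (by positivity)]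
          refine ENNReal.ofReal_le_ofReal ?_
          refine (mul_le_mul_of_nonneg_left hint (by positivity)).trans (le_of_eq ?_)
          have hw : (2 * r * (1 / 2) ^ j) ^ n ≠ 0 := by positivity
          rw [← hudef, hK]
          generalize (2 * r * (1 / 2) ^ j) ^ n = w at hw
          field_simp
  have : Nonempty (Fin n) := ⟨⟨0, hn⟩⟩
  calc ∫⁻ y in Metric.ball x r, ENNReal.ofReal (|D x y| * |f y|)
      ≤ ∫⁻ y in {x} ∪ ⋃ j, S j, ENNReal.ofReal (|D x y| * |f y|) := lintegral_mono_set hcov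
    _ ≤ (∫⁻ y in {x}, ENNReal.ofReal (|D x y| * |f y|))
          + ∫⁻ y in ⋃ j, S j, ENNReal.ofReal (|D x y| * |f y|) := lintegral_union_le _ _ _
    _ = ∫⁻ y in ⋃ j, S j, ENNReal.ofReal (|D x y| * |f y|) := by
        rw [setLIntegral_measure_zero _ _ (measure_singleton x), zero_add]
    _ ≤ ∑' j, ∫⁻ y in S j, ENNReal.ofReal (|D x y| * |f y|) := lintegral_iUnion_le _ _
    _ ≤ ∑' j : ℕ, ENNReal.ofReal (K * M * (((j : ℝ) + 1) * (1 / 2) ^ j)) :=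
        ENNReal.tsum_le_tsum hSj
    _ = ENNReal.ofReal (K * M * T) := by
        rw [← ENNReal.ofReal_tsum_of_nonneg (fun j => by positivity)
          (bmol_summable.mul_left _), tsum_mul_left]
    _ ≤ ENNReal.ofReal (K * (T + 1) * M) := by
        refine ENNReal.ofReal_le_ofReal ?_
        have : 0 ≤ K * M := by positivity
        nlinarith

end
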